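/- Let (W, S) be a Coxeter system and I ⊆ S. Every element n ∈ W with n W_I n⁻¹ = W_I admits a unique factorization n = u·w with u ∈ W_I and w ∈ 𝒲_I; moreover W_I ∩ 𝒲_I = {1}. In particular the normalizer of W_I in W is the internal semidirect product of W_I by the subgroup 𝒲_I. -/

import Mathlib

/-- The standard parabolic subgroup `W_I` of a Coxeter system, generated by the
simple reflections indexed by `I`. -/
def CoxeterSystem.parabolic {B W : Type*} [Group W] {M : CoxeterMatrix B}
    (cs : CoxeterSystem M W) (I : Set B) : Subgroup W :=
  Subgroup.closure (cs.simple '' I)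

/-- The set `𝒲_I` of all `w ∈ W` such that `w W_I w⁻¹ = W_I` and `w` has minimal
length in the coset `w W_I`. -/
def CoxeterSystem.minNormalizing {B W : Type*} [Group W] {M : CoxeterMatrix B}
    (cs : CoxeterSystem M W) (I : Set B) : Set W :=
  {w : W | (cs.parabolic I).map (MulAut.conj w).toMonoidHom = cs.parabolic I ∧
    ∀ u ∈ cs.parabolic I, cs.length w ≤ cs.length (w * u)}

theorem Function.End.coe_mul_apply {α : Type*} (f g : Function.End α) (x : α) :
    (f * g) x = f (g x) := rfl

theorem Function.End.coe_one_apply {α : Type*} (x : α) : (1 : Function.End α) x = x := rfl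

namespace CoxeterSystem

variable {B W : Type*} [Group W] {M : CoxeterMatrix B} (cs : CoxeterSystem M W)

open scoped Classical in
/-- The action of a simple reflection on `W × ZMod 2`: conjugation on the first factor, and a flip
of the second factor over the fixed simple reflection. -/
noncomputable def signedConj (i : B) : Function.End (W × ZMod 2) :=
  fun p ↦ (cs.simple i * p.1 * cs.simple i, p.2 + if p.1 = cs.simple i then 1 else 0)

open scoped Classical in
theorem signedConj_mul_pow_apply (i j : B) (k : ℕ) (p : W × ZMod 2) :
    ((cs.signedConj i * cs.signedConj j) ^ k) p =
      ((cs.simple i * cs.simple j) ^ k * p.1 * ((cs.simple i * cs.simple j) ^ k)⁻¹,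
        p.2 + ∑ l ∈ Finset.range (2 * k),
          if p.1 = cs.simple j * (cs.simple i * cs.simple j) ^ l then 1 else 0) := by
  set x := cs.simple i * cs.simple j with hx
  have hxi : x⁻¹ = cs.simple j * cs.simple i := by simp [hx]
  have hconj (n : ℕ) : (x ^ n)⁻¹ * cs.simple j = cs.simple j * x ^ n := by
    have h : SemiconjBy (cs.simple j) x x⁻¹ := by
      rw [SemiconjBy, hxi, hx, mul_assoc]
    have := (h.pow_right n).eq
    rw [inv_pow] at this
    exact this.symm
  induction k with
  | zero => simp [Function.End.coe_one_apply]
  | succ k ih =>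
    have h1 : x ^ k * p.1 * (x ^ k)⁻¹ = cs.simple j ↔ p.1 = cs.simple j * x ^ (2 * k) := by
      rw [mul_inv_eq_iff_eq_mul, ← eq_inv_mul_iff_mul_eq, ← mul_assoc, hconj, mul_assoc,
        ← pow_add, two_mul]
    have h2 : cs.simple j * (x ^ k * p.1 * (x ^ k)⁻¹) * cs.simple j = cs.simple i ↔
        p.1 = cs.simple j * x ^ (2 * k + 1) := by
      have : cs.simple j * (x ^ k * p.1 * (x ^ k)⁻¹) * cs.simple j = cs.simple i ↔
          x ^ k * p.1 * (x ^ k)⁻¹ = cs.simple j * x := by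
        rw [← eq_mul_inv_iff_mul_eq, inv_simple, ← hx, ← eq_inv_mul_iff_mul_eq, inv_simple]
      rw [this, mul_inv_eq_iff_eq_mul, ← eq_inv_mul_iff_mul_eq, ← mul_assoc, ← mul_assoc, hconj,
        mul_assoc, mul_assoc, ← pow_succ', ← pow_add]
      ring_nf
    rw [pow_succ', Function.End.coe_mul_apply, ih, Function.End.coe_mul_apply,
      signedConj, signedConj]
    simp only [h1, h2]
    rw [Nat.mul_succ, Finset.sum_range_succ, Finset.sum_range_succ]
    refine Prod.ext ?_ ?_
    · simp only [pow_succ', mul_inv_rev, hxi]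
      simp only [hx, mul_assoc]
    · simp only [add_assoc]

theorem isLiftable_signedConj : M.IsLiftable cs.signedConj := by
  classical
  intro i j
  funext p
  rw [signedConj_mul_pow_apply, two_mul, Finset.sum_range_add]
  simp [pow_add, CharTwo.add_self_eq_zero, Function.End.coe_one_apply]

open scoped Classical in
theorem lift_signedConj_wordProd (ω : List B) (p : W × ZMod 2) :
    cs.lift ⟨cs.signedConj, cs.isLiftable_signedConj⟩ (cs.wordProd ω) p =
      (cs.wordProd ω * p.1 * (cs.wordProd ω)⁻¹, p.2 + (cs.rightInvSeq ω).count p.1) := by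
  induction ω with
  | nil => simp [Function.End.coe_one_apply]
  | cons i ω ih =>
    have h : cs.wordProd ω * p.1 * (cs.wordProd ω)⁻¹ = cs.simple i ↔
        (cs.wordProd ω)⁻¹ * cs.simple i * cs.wordProd ω = p.1 := by
      rw [mul_inv_eq_iff_eq_mul, ← eq_inv_mul_iff_mul_eq, ← mul_assoc, eq_comm]
    rw [wordProd_cons, map_mul, Function.End.coe_mul_apply, ih, lift_apply_simple,
      signedConj, rightInvSeq, List.count_cons]
    simp only [h, beq_iff_eq]
    refine Prod.ext ?_ ?_
    · simp [mul_assoc]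
    · simp [add_assoc]

/-- The parity of the number of occurrences of `t` in the right inversion sequence of any word
representing `w`. -/
noncomputable def inversionParity (w t : W) : ZMod 2 :=
  (cs.lift ⟨cs.signedConj, cs.isLiftable_signedConj⟩ w (t, 0)).2

open scoped Classical in
theorem inversionParity_wordProd (ω : List B) (t : W) :
    cs.inversionParity (cs.wordProd ω) t = (cs.rightInvSeq ω).count t := by
  simp [inversionParity, lift_signedConj_wordProd]

theorem inversionParity_mul (w u t : W) :
    cs.inversionParity (w * u) t =
      cs.inversionParity u t + cs.inversionParity w (u * t * u⁻¹) := by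
  classical
  obtain ⟨ω, rfl⟩ := cs.wordProd_surjective w
  obtain ⟨υ, rfl⟩ := cs.wordProd_surjective u
  simp [inversionParity, lift_signedConj_wordProd, Function.End.coe_mul_apply]

theorem length_mul_lt_of_inversionParity_ne_zero {w t : W} (h : cs.inversionParity w t ≠ 0) :
    cs.length (w * t) < cs.length w := by
  classical
  obtain ⟨ω, hω, rfl⟩ := cs.exists_isReduced w
  rw [inversionParity_wordProd] at h
  refine (cs.isRightInversion_of_mem_rightInvSeq hω (List.count_pos_iff.mp ?_)).2
  exact Nat.pos_of_ne_zero fun h0 ↦ h (by simp [h0])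

theorem eq_one_of_inversionParity_eq_zero {w : W} (h : ∀ t, cs.inversionParity w t = 0) :
    w = 1 := by
  classical
  obtain ⟨ω, hω, rfl⟩ := cs.exists_isReduced w
  cases ω with
  | nil => simp
  | cons i ω =>
    have hmem : (cs.wordProd ω)⁻¹ * cs.simple i * cs.wordProd ω ∈ cs.rightInvSeq (i :: ω) := by
      simp [rightInvSeq]
    have h1 := h ((cs.wordProd ω)⁻¹ * cs.simple i * cs.wordProd ω)
    rw [inversionParity_wordProd, List.count_eq_one_of_mem hω.nodup_rightInvSeq hmem] at h1
    simp at h1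

variable (I : Set B)

theorem exists_wordProd_eq_of_mem_parabolic {u : W} (hu : u ∈ cs.parabolic I) :
    ∃ ω : List B, cs.wordProd ω = u ∧ ∀ i ∈ ω, i ∈ I := by
  induction hu using Subgroup.closure_induction with
  | mem x hx =>
    obtain ⟨i, hi, rfl⟩ := hx
    exact ⟨[i], by simp, by simpa using hi⟩
  | one => exact ⟨[], by simp, by simp⟩
  | mul x y _ _ hx hy =>
    obtain ⟨ω, rfl, hω⟩ := hx
    obtain ⟨υ, rfl, hυ⟩ := hy
    refine ⟨ω ++ υ, cs.wordProd_append ω υ, fun i hi ↦ ?_⟩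
    exact (List.mem_append.mp hi).elim (hω i) (hυ i)
  | inv x _ hx =>
    obtain ⟨ω, rfl, hω⟩ := hx
    exact ⟨ω.reverse, cs.wordProd_reverse ω, fun i hi ↦ hω i (List.mem_reverse.mp hi)⟩

theorem wordProd_mem_parabolic {ω : List B} (hω : ∀ i ∈ ω, i ∈ I) :
    cs.wordProd ω ∈ cs.parabolic I := by
  refine Subgroup.list_prod_mem _ fun x hx ↦ ?_
  obtain ⟨i, hi, rfl⟩ := List.mem_map.mp hx
  exact Subgroup.subset_closure ⟨i, hω i hi, rfl⟩

theorem mem_parabolic_of_mem_rightInvSeq {ω : List B} (hω : ∀ i ∈ ω, i ∈ I) {t : W}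
    (ht : t ∈ cs.rightInvSeq ω) : t ∈ cs.parabolic I := by
  induction ω with
  | nil => simp at ht
  | cons i ω ih =>
    have hω' : ∀ j ∈ ω, j ∈ I := fun j hj ↦ hω j (List.mem_cons_of_mem i hj)
    rcases List.mem_cons.mp ht with rfl | ht
    · have h1 := cs.wordProd_mem_parabolic I hω'
      have h2 : cs.simple i ∈ cs.parabolic I :=
        Subgroup.subset_closure ⟨i, hω i List.mem_cons_self, rfl⟩
      exact mul_mem (mul_mem (inv_mem h1) h2) h1
    · exact ih hω' ht

/-- A coset `w W_I` contains at most one element of minimal length. -/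
theorem eq_one_of_forall_length_le {w u : W} (hu : u ∈ cs.parabolic I)
    (hw : ∀ v ∈ cs.parabolic I, cs.length w ≤ cs.length (w * v))
    (hwu : ∀ v ∈ cs.parabolic I, cs.length (w * u) ≤ cs.length (w * u * v)) : u = 1 := by
  classical
  refine cs.eq_one_of_inversionParity_eq_zero fun t ↦ ?_
  by_cases ht : t ∈ cs.parabolic I
  · have zero_of_min {x : W} (hx : ∀ v ∈ cs.parabolic I, cs.length x ≤ cs.length (x * v)) {r : W}
        (hr : r ∈ cs.parabolic I) : cs.inversionParity x r = 0 := by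
      by_contra h
      exact (cs.length_mul_lt_of_inversionParity_ne_zero h).not_ge (hx r hr)
    have h := cs.inversionParity_mul w u t
    rwa [zero_of_min hwu ht, zero_of_min hw (mul_mem (mul_mem hu ht) (inv_mem hu)), add_zero,
      eq_comm] at h
  · obtain ⟨ω, rfl, hω⟩ := cs.exists_wordProd_eq_of_mem_parabolic I hu
    rw [inversionParity_wordProd, List.count_eq_zero_of_not_mem, Nat.cast_zero]
    exact fun h ↦ ht (cs.mem_parabolic_of_mem_rightInvSeq I hω h)

theorem exists_forall_length_le (n : W) : ∃ u ∈ cs.parabolic I,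
    ∀ v ∈ cs.parabolic I, cs.length (n * u) ≤ cs.length (n * u * v) := by
  obtain ⟨u, hu, hmin⟩ := WellFounded.has_min
    (InvImage.wf (fun u ↦ cs.length (n * u)) Nat.lt_wfRel.wf) (cs.parabolic I : Set W) ⟨1, one_mem _⟩
  refine ⟨u, hu, fun v hv ↦ ?_⟩
  rw [mul_assoc]
  exact not_lt.mp (hmin (u * v) (mul_mem hu hv))

end CoxeterSystem

/-- Every `n ∈ W` with `n W_I n⁻¹ = W_I` factors uniquely as `n = u * w`
with `u ∈ W_I`, `w ∈ 𝒲_I`; moreover `W_I ∩ 𝒲_I = {1}`. Hence the normalizer of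
`W_I` is the internal semidirect product of `W_I` by `𝒲_I`. -/
theorem normalizer_semidirect_decomposition {B W : Type*} [Group W] {M : CoxeterMatrix B}
    (cs : CoxeterSystem M W) (I : Set B) :
    (∀ n : W, (cs.parabolic I).map (MulAut.conj n).toMonoidHom = cs.parabolic I →
      ∃! p : W × W, p.1 ∈ cs.parabolic I ∧ p.2 ∈ cs.minNormalizing I ∧ n = p.1 * p.2) ∧
    (cs.parabolic I : Set W) ∩ cs.minNormalizing I = {1} := by
  have conj_mem {w u : W}
      (hw : (cs.parabolic I).map (MulAut.conj w).toMonoidHom = cs.parabolic I)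
      (hu : u ∈ cs.parabolic I) : w * u * w⁻¹ ∈ cs.parabolic I := by
    rw [← hw]
    exact ⟨u, hu, rfl⟩
  have inv_conj_mem {w u : W}
      (hw : (cs.parabolic I).map (MulAut.conj w).toMonoidHom = cs.parabolic I)
      (hu : u ∈ cs.parabolic I) : w⁻¹ * u * w ∈ cs.parabolic I := by
    rw [← hw] at hu
    obtain ⟨v, hv, rfl⟩ := hu
    simpa [mul_assoc] using hv
  refine ⟨fun n hn ↦ ?_, ?_⟩
  · obtain ⟨u, hu, hmin⟩ := cs.exists_forall_length_le I n
    refine ⟨(n * u⁻¹ * n⁻¹, n * u), ⟨conj_mem hn (inv_mem hu), ⟨?_, hmin⟩, by group⟩, ?_⟩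
    · ext x
      constructor
      · rintro ⟨v, hv, rfl⟩
        have := conj_mem hn (mul_mem (mul_mem hu hv) (inv_mem hu))
        simpa [mul_assoc] using this
      · intro hx
        refine ⟨u⁻¹ * (n⁻¹ * x * n) * u, mul_mem (mul_mem (inv_mem hu) (inv_conj_mem hn hx)) hu, ?_⟩
        simp [mul_assoc]
    · rintro ⟨v, w⟩ ⟨hv, ⟨hw, hwmin⟩, rfl⟩
      dsimp only at hv hw hwmin hmin ⊢
      have hmem : w⁻¹ * v * w * u ∈ cs.parabolic I := mul_mem (inv_conj_mem hw hv) hu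
      have hnu : v * w * u = w * (w⁻¹ * v * w * u) := by group
      have h1 : w⁻¹ * v * w * u = 1 :=
        cs.eq_one_of_forall_length_le I hmem hwmin (by rwa [← hnu])
      have h2 : v * w * u = w := by rw [hnu, h1, mul_one]
      refine Prod.ext ?_ h2.symm
      have h3 : v * w * u⁻¹ * (v * w)⁻¹ = v * w * (v * w * u)⁻¹ := by group
      rw [h3, h2, mul_inv_cancel_right]
  · ext w
    constructor
    · rintro ⟨hw, -, hmin⟩
      have := hmin w⁻¹ (inv_mem hw)
      rw [mul_inv_cancel, cs.length_one, Nat.le_zero, cs.length_eq_zero_iff] at this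
      exact this
    · rintro rfl
      refine ⟨one_mem _, ?_, by simp⟩
      ext x
      simp
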